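/- arXiv:1205.3513 — 2 statements merged into one kernel-verified Lean document; each statement's English description precedes it below -/
import Mathlib

section
/- Let Ω ⊆ ℍ be a symmetric slice domain and let f : Ω → ℍ be a non-constant slice regular function that is continuously real-differentiable on Ω. Then the singular set N_f = {q ∈ Ω : the real differential Df(q) : ℍ → ℍ is not bijective} has empty interior in Ω. -/
open Quaternion
open Quaternion

/-- The 2-sphere of imaginary units of `ℍ`. -/
def QSphere : Set ℍ := {q : ℍ | q ^ 2 = -1}

/-- The slice `L_I = ℝ + ℝ I` of `ℍ`, as a set. -/
def QSlice (I : ℍ) : Set ℍ := {q : ℍ | ∃ x y : ℝ, q = (x : ℍ) + y • I}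

/-- `Ω` is a symmetric slice domain. -/
def IsSymmSliceDomain (Ω : Set ℍ) : Prop :=
  IsOpen Ω ∧ IsConnected Ω ∧ (∃ x : ℝ, (x : ℍ) ∈ Ω) ∧
  (∀ I ∈ QSphere, IsConnected (Ω ∩ QSlice I)) ∧
  (∀ x y : ℝ, ∀ I ∈ QSphere, ∀ J ∈ QSphere, (x : ℍ) + y • I ∈ Ω → (x : ℍ) + y • J ∈ Ω)

/-- `f` is slice regular on `Ω`: (really) differentiable, and on each slice `ℝ + ℝ I` the
Cauchy–Riemann equation `(∂/∂x + I ∂/∂y) f = 0` holds, i.e. `Df(q) 1 + I · Df(q) I = 0`. -/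
def SliceRegularOn (f : ℍ → ℍ) (Ω : Set ℍ) : Prop :=
  (∀ q ∈ Ω, DifferentiableAt ℝ f q) ∧
  ∀ I ∈ QSphere, ∀ q ∈ Ω ∩ QSlice I, fderiv ℝ f q 1 + I * fderiv ℝ f q I = 0

theorem mem_QSphere_iff_mul_self (q : ℍ) : q ∈ QSphere ↔ q * q = -1 := by
  rw [QSphere, Set.mem_ofPred_eq, sq]

theorem mem_QSphere_iff (q : ℍ) :
    q ∈ QSphere ↔ q.re = 0 ∧ q.imI ^ 2 + q.imJ ^ 2 + q.imK ^ 2 = 1 := by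
  rw [mem_QSphere_iff_mul_self]
  constructor
  · intro h
    have h0 := congrArg QuaternionAlgebra.re h
    have h1 := congrArg QuaternionAlgebra.imI h
    have h2 := congrArg QuaternionAlgebra.imJ h
    have h3 := congrArg QuaternionAlgebra.imK h
    simp at h0 h1 h2 h3
    have hr : q.re = 0 := by
      by_contra hr
      have e1 : q.imI = 0 := by
        have : q.re * q.imI = 0 := by linarith
        simpa [hr] using this
      have e2 : q.imJ = 0 := by
        have : q.re * q.imJ = 0 := by linarith
        simpa [hr] using this
      have e3 : q.imK = 0 := by
        have : q.re * q.imK = 0 := by linarith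
        simpa [hr] using this
      rw [e1, e2, e3] at h0
      nlinarith [sq_nonneg q.re]
    refine ⟨hr, ?_⟩
    rw [hr] at h0
    linarith
  · rintro ⟨h0, h1⟩
    ext <;> simp [h0] <;> linarith

theorem cos_smul_add_sin_smul_mem_QSphere {I J : ℍ} (hI : I ∈ QSphere) (hJ : J ∈ QSphere)
    (hIJ : (I * J).re = 0) (θ : ℝ) : Real.cos θ • I + Real.sin θ • J ∈ QSphere := by
  rw [mem_QSphere_iff] at *
  obtain ⟨h0, h1⟩ := hI
  obtain ⟨k0, k1⟩ := hJ
  simp [h0, k0] at hIJ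
  refine ⟨by simp [h0, k0], ?_⟩
  simp only [Quaternion.imI_add, Quaternion.imJ_add, Quaternion.imK_add, Quaternion.imI_smul,
    Quaternion.imJ_smul, Quaternion.imK_smul, smul_eq_mul]
  linear_combination (Real.cos θ) ^ 2 * h1 + (Real.sin θ) ^ 2 * k1
    - 2 * Real.cos θ * Real.sin θ * hIJ + Real.sin_sq_add_cos_sq θ

/-- The real-linear parametrization `z ↦ Re z + (Im z) I` of the slice `ℝ + ℝ I`. -/
noncomputable def sliceMap (I : ℍ) : ℂ →L[ℝ] ℍ :=
  Complex.reCLM.smulRight (1 : ℍ) + Complex.imCLM.smulRight I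

theorem sliceMap_apply (I : ℍ) (z : ℂ) : sliceMap I z = (z.re : ℍ) + z.im • I := by
  simp [sliceMap, ← Quaternion.coe_one, ← Quaternion.coe_smul]

theorem sliceMap_one (I : ℍ) : sliceMap I 1 = 1 := by simp [sliceMap]

theorem sliceMap_I (I : ℍ) : sliceMap I Complex.I = I := by simp [sliceMap]

/-- `g` is holomorphic on `D` for the complex structure on `ℍ` given by left multiplication
by `I`. -/
def LeftHolomorphicOn (I : ℍ) (g : ℂ → ℍ) (D : Set ℂ) : Prop :=
  ∀ z ∈ D, DifferentiableAt ℝ g z ∧ fderiv ℝ g z Complex.I = I * fderiv ℝ g z 1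

/-- The complex-linear functional on `(ℍ, I)` with real part `⟪w, ·⟫`. -/
noncomputable def leftFunctional (I w : ℍ) : ℍ →L[ℝ] ℂ :=
  (innerSL ℝ w).smulRight (1 : ℂ) -
    ((innerSL ℝ w).comp (ContinuousLinearMap.mul ℝ ℍ I)).smulRight Complex.I

theorem leftFunctional_mul {I : ℍ} (hI : I ∈ QSphere) (w q : ℍ) :
    leftFunctional I w (I * q) = Complex.I * leftFunctional I w q := by
  rw [mem_QSphere_iff_mul_self] at hI
  apply Complex.ext <;> simp [leftFunctional, ← mul_assoc, hI]

theorem leftFunctional_re (I w q : ℍ) : (leftFunctional I w q).re = inner ℝ w q := by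
  simp [leftFunctional]

theorem LeftHolomorphicOn.eqOn_zero {I : ℍ} (hI : I ∈ QSphere) {g : ℂ → ℍ} {D : Set ℂ}
    (hD : IsOpen D) (hc : IsPreconnected D) (hg : LeftHolomorphicOn I g D) {z₀ : ℂ} (h₀ : z₀ ∈ D)
    (hfr : ∃ᶠ z in nhdsWithin z₀ {z₀}ᶜ, g z = 0) : ∀ z ∈ D, g z = 0 := by
  intro z hz
  set φ := leftFunctional I (g z) with hφ
  have hd : DifferentiableOn ℂ (fun u => φ (g u)) D := by
    intro u hu
    obtain ⟨hu1, hu2⟩ := hg u hu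
    apply DifferentiableAt.differentiableWithinAt
    have hfd : HasFDerivAt (fun u => φ (g u)) (φ.comp (fderiv ℝ g u)) u :=
      φ.hasFDerivAt.comp u hu1.hasFDerivAt
    rw [differentiableAt_complex_iff_differentiableAt_real]
    refine ⟨hfd.differentiableAt, ?_⟩
    rw [hfd.fderiv]
    simp [hu2, hφ, leftFunctional_mul hI]
  have han : AnalyticOnNhd ℂ (fun u => φ (g u)) D := hd.analyticOnNhd hD
  have h := han.eqOn_zero_of_preconnected_of_frequently_eq_zero hc h₀
    (hfr.mono fun u hu => by simp [hu]) hz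
  have h' := congrArg Complex.re h
  simpa [hφ, leftFunctional_re] using h'

/-- The set of parameters of the slices of an axially symmetric set. -/
def profile (Ω : Set ℍ) : Set ℂ := {z | ∀ I ∈ QSphere, sliceMap I z ∈ Ω}

theorem neg_mem_QSphere {I : ℍ} (hI : I ∈ QSphere) : -I ∈ QSphere := by
  rw [mem_QSphere_iff_mul_self] at *
  simpa using hI

/-- The basis quaternion `i`. -/
def unitI : ℍ := ⟨0, 1, 0, 0⟩

@[simp] theorem re_unitI : unitI.re = 0 := rfl

@[simp] theorem imI_unitI : unitI.imI = 1 := rfl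

@[simp] theorem imJ_unitI : unitI.imJ = 0 := rfl

@[simp] theorem imK_unitI : unitI.imK = 0 := rfl

theorem unitI_mem_QSphere : unitI ∈ QSphere := by
  rw [mem_QSphere_iff]
  simp [unitI]

theorem sliceMap_conj (I : ℍ) (z : ℂ) :
    sliceMap I (starRingEnd ℂ z) = sliceMap (-I) z := by
  simp [sliceMap_apply]

namespace IsSymmSliceDomain

variable {Ω : Set ℍ}

theorem mem_profile_iff (hΩ : IsSymmSliceDomain Ω) {I : ℍ} (hI : I ∈ QSphere) {z : ℂ} :
    z ∈ profile Ω ↔ sliceMap I z ∈ Ω := by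
  refine ⟨fun h => h I hI, fun h J hJ => ?_⟩
  rw [sliceMap_apply] at *
  exact hΩ.2.2.2.2 _ _ I hI J hJ h

theorem profile_eq_preimage (hΩ : IsSymmSliceDomain Ω) {I : ℍ} (hI : I ∈ QSphere) :
    profile Ω = sliceMap I ⁻¹' Ω :=
  Set.ext fun _ => hΩ.mem_profile_iff hI

theorem isOpen_profile (hΩ : IsSymmSliceDomain Ω) : IsOpen (profile Ω) := by
  rw [hΩ.profile_eq_preimage unitI_mem_QSphere]
  exact hΩ.1.preimage (sliceMap unitI).continuous

theorem conj_mem_profile {z : ℂ} (hz : z ∈ profile Ω) :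
    starRingEnd ℂ z ∈ profile Ω := fun I hI => by
  rw [sliceMap_conj]
  exact hz _ (neg_mem_QSphere hI)

theorem isPreconnected_profile (hΩ : IsSymmSliceDomain Ω) : IsPreconnected (profile Ω) := by
  have hc := (hΩ.2.2.2.1 unitI unitI_mem_QSphere).isPreconnected
  have himg : profile Ω = (fun q : ℍ => (⟨q.re, q.imI⟩ : ℂ)) '' (Ω ∩ QSlice unitI) := by
    ext z
    rw [hΩ.mem_profile_iff unitI_mem_QSphere]
    constructor
    · intro h
      exact ⟨_, ⟨h, z.re, z.im, sliceMap_apply _ _⟩, by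
        apply Complex.ext <;> simp [sliceMap_apply]⟩
    · rintro ⟨q, ⟨hq, x, y, rfl⟩, rfl⟩
      simpa [sliceMap_apply] using hq
  rw [himg]
  refine hc.image _ (Continuous.continuousOn ?_)
  have : (fun q : ℍ => (⟨q.re, q.imI⟩ : ℂ)) = fun q : ℍ => (q.re : ℂ) + q.imI * Complex.I := by
    funext q
    apply Complex.ext <;> simp
  rw [this]
  have h1 := Quaternion.continuous_re
  have h2 := Quaternion.continuous_imI
  fun_prop

theorem exists_real_mem_profile (hΩ : IsSymmSliceDomain Ω) : ∃ x : ℝ, (x : ℂ) ∈ profile Ω := by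
  obtain ⟨x, hx⟩ := hΩ.2.2.1
  exact ⟨x, fun I _ => by simpa [sliceMap_apply] using hx⟩

end IsSymmSliceDomain

theorem exists_eq_smul_mem_QSphere {v : ℍ} (hv : v.re = 0) (h : v ≠ 0) :
    ∃ J ∈ QSphere, ∃ r : ℝ, v = r • J := by
  have hn : ‖v‖ ≠ 0 := norm_ne_zero_iff.mpr h
  refine ⟨‖v‖⁻¹ • v, ?_, ‖v‖, by simp [smul_smul, hn]⟩
  have h2 : v * v = -((‖v‖ * ‖v‖ : ℝ) : ℍ) := by
    have hs : star v = -v := by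
      ext <;> simp [hv]
    rw [← Quaternion.normSq_eq_norm_mul_self, ← Quaternion.self_mul_star, hs]
    simp
  rw [mem_QSphere_iff_mul_self, smul_mul_smul_comm, h2, smul_neg, ← Quaternion.coe_smul,
    smul_eq_mul, ← mul_inv, inv_mul_cancel₀ (mul_ne_zero hn hn), Quaternion.coe_one]

theorem exists_sliceMap_eq (q : ℍ) : ∃ I ∈ QSphere, ∃ z : ℂ, q = sliceMap I z := by
  by_cases h : q.im = 0
  · refine ⟨unitI, unitI_mem_QSphere, q.re, ?_⟩
    rw [sliceMap_apply]
    simpa [h] using (Quaternion.re_add_im q).symm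
  · obtain ⟨J, hJ, r, hr⟩ := exists_eq_smul_mem_QSphere (Quaternion.re_im q) h
    refine ⟨J, hJ, ⟨q.re, r⟩, ?_⟩
    rw [sliceMap_apply]
    simp [← hr]

theorem SliceRegularOn.leftHolomorphicOn {Ω : Set ℍ} {f : ℍ → ℍ} (hf : SliceRegularOn f Ω)
    {I : ℍ} (hI : I ∈ QSphere) :
    LeftHolomorphicOn I (fun z => f (sliceMap I z)) (profile Ω) := by
  intro z hz
  have hq := hz I hI
  have hd : HasFDerivAt (fun z => f (sliceMap I z))
      ((fderiv ℝ f (sliceMap I z)).comp (sliceMap I)) z :=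
    (hf.1 _ hq).hasFDerivAt.comp z (sliceMap I).hasFDerivAt
  refine ⟨hd.differentiableAt, ?_⟩
  rw [hd.fderiv]
  have h := hf.2 I hI _ ⟨hq, z.re, z.im, sliceMap_apply I z⟩
  have h' := congrArg (I * ·) h
  rw [mem_QSphere_iff_mul_self] at hI
  simp only [mul_add, ← mul_assoc, hI, neg_mul, one_mul, mul_zero, add_neg_eq_zero] at h'
  simpa [sliceMap_one, sliceMap_I] using h'.symm

/-- `α + I β` satisfies the Cauchy-Riemann equations on `D` for an abstract imaginary unit `I`. -/
def StemCauchyRiemann (α β : ℂ → ℍ) (D : Set ℂ) : Prop :=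
  ∀ z ∈ D, DifferentiableAt ℝ α z ∧ DifferentiableAt ℝ β z ∧
    fderiv ℝ α z Complex.I = -fderiv ℝ β z 1 ∧ fderiv ℝ β z Complex.I = fderiv ℝ α z 1

theorem hasFDerivAt_add_mul {α β : ℂ → ℍ} {z : ℂ} (hα : DifferentiableAt ℝ α z)
    (hβ : DifferentiableAt ℝ β z) (J : ℍ) :
    HasFDerivAt (fun z => α z + J * β z)
      (fderiv ℝ α z + (ContinuousLinearMap.mul ℝ ℍ J).comp (fderiv ℝ β z)) z :=
  hα.hasFDerivAt.add ((ContinuousLinearMap.mul ℝ ℍ J).hasFDerivAt.comp z hβ.hasFDerivAt)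

theorem StemCauchyRiemann.leftHolomorphicOn {α β : ℂ → ℍ} {D : Set ℂ}
    (h : StemCauchyRiemann α β D) {J : ℍ} (hJ : J ∈ QSphere) :
    LeftHolomorphicOn J (fun z => α z + J * β z) D := by
  intro z hz
  obtain ⟨hα, hβ, h1, h2⟩ := h z hz
  have hd := hasFDerivAt_add_mul hα hβ J
  refine ⟨hd.differentiableAt, ?_⟩
  rw [hd.fderiv]
  rw [mem_QSphere_iff_mul_self] at hJ
  simp [h1, h2, mul_add, ← mul_assoc, hJ, add_comm]

theorem LeftHolomorphicOn.sub {I : ℍ} {g k : ℂ → ℍ} {D : Set ℂ} (hg : LeftHolomorphicOn I g D)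
    (hk : LeftHolomorphicOn I k D) : LeftHolomorphicOn I (fun z => g z - k z) D := by
  intro z hz
  obtain ⟨hg1, hg2⟩ := hg z hz
  obtain ⟨hk1, hk2⟩ := hk z hz
  refine ⟨hg1.sub hk1, ?_⟩
  rw [fderiv_fun_sub hg1 hk1]
  simp [hg2, hk2, mul_sub]

theorem LeftHolomorphicOn.sub_const {I : ℍ} {g : ℂ → ℍ} {D : Set ℂ}
    (hg : LeftHolomorphicOn I g D) (c : ℍ) : LeftHolomorphicOn I (fun z => g z - c) D := by
  intro z hz
  obtain ⟨hg1, hg2⟩ := hg z hz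
  refine ⟨hg1.sub_const c, ?_⟩
  rw [fderiv_sub_const]
  exact hg2

theorem LeftHolomorphicOn.stemCauchyRiemann {I : ℍ} (hI : I ∈ QSphere) {g k : ℂ → ℍ} {D : Set ℂ}
    (hg : LeftHolomorphicOn I g D) (hk : LeftHolomorphicOn (-I) k D) :
    StemCauchyRiemann (fun z => (2⁻¹ : ℝ) • (g z + k z))
      (fun z => (2⁻¹ : ℝ) • (I * (k z - g z))) D := by
  intro z hz
  obtain ⟨hg1, hg2⟩ := hg z hz
  obtain ⟨hk1, hk2⟩ := hk z hz
  rw [mem_QSphere_iff_mul_self] at hI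
  have hα : HasFDerivAt (fun z => (2⁻¹ : ℝ) • (g z + k z)) _ z :=
    (hg1.hasFDerivAt.add hk1.hasFDerivAt).const_smul (2⁻¹ : ℝ)
  have hβ : HasFDerivAt (fun z => (2⁻¹ : ℝ) • (I * (k z - g z))) _ z :=
    ((ContinuousLinearMap.mul ℝ ℍ I).hasFDerivAt.comp z
      (hk1.hasFDerivAt.sub hg1.hasFDerivAt)).const_smul (2⁻¹ : ℝ)
  refine ⟨hα.differentiableAt, hβ.differentiableAt, ?_, ?_⟩
  · rw [hα.fderiv, hβ.fderiv]
    simp [hg2, hk2, smul_sub]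
    abel
  · rw [hα.fderiv, hβ.fderiv]
    simp [hg2, hk2, ← mul_assoc, hI]
    abel

theorem frequently_real (x : ℝ) :
    ∃ᶠ z : ℂ in nhdsWithin (x : ℂ) {(x : ℂ)}ᶜ, ∃ t : ℝ, z = t := by
  have ht : Filter.Tendsto (fun t : ℝ => (t : ℂ)) (nhdsWithin x {x}ᶜ)
      (nhdsWithin (x : ℂ) {(x : ℂ)}ᶜ) :=
    Complex.continuous_ofReal.continuousWithinAt.tendsto_nhdsWithin fun t ht => by simpa using ht
  exact ht.frequently (Filter.Eventually.frequently (Filter.Eventually.of_forall fun t => ⟨t, rfl⟩))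

/-- The representation formula for slice regular functions. -/
theorem SliceRegularOn.exists_stem {Ω : Set ℍ} (hΩ : IsSymmSliceDomain Ω) {f : ℍ → ℍ}
    (hf : SliceRegularOn f Ω) :
    ∃ α β : ℂ → ℍ, StemCauchyRiemann α β (profile Ω) ∧
      ∀ J ∈ QSphere, ∀ z ∈ profile Ω, f (sliceMap J z) = α z + J * β z := by
  have hI := unitI_mem_QSphere
  have hcr := (hf.leftHolomorphicOn hI).stemCauchyRiemann hI
    (hf.leftHolomorphicOn (neg_mem_QSphere hI))
  refine ⟨_, _, hcr, fun J hJ z hz => ?_⟩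
  obtain ⟨x, hx⟩ := hΩ.exists_real_mem_profile
  have h := ((hf.leftHolomorphicOn hJ).sub (hcr.leftHolomorphicOn hJ)).eqOn_zero hJ
    hΩ.isOpen_profile hΩ.isPreconnected_profile hx
    ((frequently_real x).mono ?_) z hz
  · exact sub_eq_zero.mp h
  · rintro _ ⟨t, rfl⟩
    simp [sliceMap_apply, ← two_smul ℝ (f t), smul_smul]

/-- The differential in the directions orthogonal to the slice is given by the spherical
derivative. -/
theorem smul_fderiv_of_orthogonal {f : ℍ → ℍ} {I J a b : ℍ} {z : ℂ} (hI : I ∈ QSphere)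
    (hJ : J ∈ QSphere) (hIJ : (I * J).re = 0) (hd : DifferentiableAt ℝ f (sliceMap I z))
    (hf : ∀ K ∈ QSphere, f (sliceMap K z) = a + K * b) :
    z.im • fderiv ℝ f (sliceMap I z) J = J * b := by
  have hK : HasDerivAt (fun θ : ℝ => Real.cos θ • I + Real.sin θ • J) J 0 := by
    have := ((Real.hasDerivAt_cos 0).smul_const I).add ((Real.hasDerivAt_sin 0).smul_const J)
    rw [Real.sin_zero, Real.cos_zero, neg_zero, zero_smul, zero_add, one_smul] at this
    exact this
  have hc : HasDerivAt (fun θ : ℝ => sliceMap (Real.cos θ • I + Real.sin θ • J) z)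
      (z.im • J) 0 := by
    simp only [sliceMap_apply]
    exact (hK.const_smul z.im).const_add _
  have h1 : HasDerivAt (fun θ : ℝ => f (sliceMap (Real.cos θ • I + Real.sin θ • J) z))
      (fderiv ℝ f (sliceMap I z) (z.im • J)) 0 := by
    refine HasFDerivAt.comp_hasDerivAt_of_eq (0 : ℝ) hd.hasFDerivAt hc ?_
    simp
  have h2 : HasDerivAt (fun θ : ℝ => f (sliceMap (Real.cos θ • I + Real.sin θ • J) z))
      (J * b) 0 := by
    have : (fun θ : ℝ => f (sliceMap (Real.cos θ • I + Real.sin θ • J) z)) =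
        fun θ : ℝ => a + (Real.cos θ • I + Real.sin θ • J) * b := by
      funext θ
      exact hf _ (cos_smul_add_sin_smul_mem_QSphere hI hJ hIJ θ)
    rw [this]
    exact (hK.mul_const b).const_add a
  rw [← map_smul]
  exact h1.unique h2

theorem re_eq_zero_of_not_injective {I a b : ℍ} (hI : I ∈ QSphere) {y : ℝ} (hy : y ≠ 0)
    {L : ℍ →L[ℝ] ℍ} (h1 : L 1 = a) (hLI : L I = I * a)
    (hLJ : ∀ J ∈ QSphere, (I * J).re = 0 → y • L J = J * b) (hL : ¬ Function.Injective L) :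
    (a * star b).re = 0 ∧ (I * (a * star b)).re = 0 := by
  have hII := (mem_QSphere_iff_mul_self I).mp hI
  have hI0 : I.re = 0 := ((mem_QSphere_iff I).mp hI).1
  obtain ⟨h, hh, h0⟩ : ∃ h, L h = 0 ∧ h ≠ 0 := by
    by_contra! hcon
    exact hL ((injective_iff_map_eq_zero L).mpr hcon)
  obtain ⟨s, hs⟩ : ∃ s : ℝ, s = h.re := ⟨_, rfl⟩
  obtain ⟨t, ht⟩ : ∃ t : ℝ, t = -(I * h).re := ⟨_, rfl⟩
  obtain ⟨v, hv⟩ : ∃ v : ℍ, v = h - s • (1 : ℍ) - t • I := ⟨_, rfl⟩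
  have hv0 : v.re = 0 := by simp [hv, hs, hI0]
  have hIv : (I * v).re = 0 := by
    rw [hv, mul_sub, mul_sub, mul_smul_comm, mul_smul_comm, hII, mul_one]
    simp [hI0, ht]
  have hLv : y • L v = v * b := by
    by_cases hv' : v = 0
    · simp [hv']
    · obtain ⟨J, hJ, r, rfl⟩ := exists_eq_smul_mem_QSphere hv0 hv'
      have hr : r ≠ 0 := by
        rintro rfl
        simp at hv'
      have : (I * J).re = 0 := by
        rw [mul_smul_comm] at hIv
        simpa [hr] using hIv
      rw [map_smul, smul_comm, hLJ J hJ this, smul_mul_assoc]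
  have hhv : h = s • (1 : ℍ) + t • I + v := by
    rw [hv]
    abel
  have hsum : y • (s • a + t • (I * a)) + v * b = 0 := by
    rw [← hLv, ← smul_add]
    have : L h = s • a + t • (I * a) + L v := by
      conv_lhs => rw [hhv]
      simp [h1, hLI]
    rw [← this, hh, smul_zero]
  obtain ⟨c, hc⟩ : ∃ c, c = a * star b := ⟨_, rfl⟩
  have hsum' : y • (s • c + t • (I * c)) + Quaternion.normSq b • v = 0 := by
    have := congrArg (· * star b) hsum
    simp only [add_mul, smul_mul_assoc, zero_mul, mul_assoc, Quaternion.self_mul_star] at this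
    rw [hc, ← this, ← Quaternion.coe_mul_eq_smul _ v, Quaternion.coe_commutes]
  have e1 := congrArg QuaternionAlgebra.re hsum'
  have e2 : (I * (y • (s • c + t • (I * c)) + Quaternion.normSq b • v)).re = 0 := by
    rw [hsum']
    simp
  simp only [mul_add, mul_smul_comm, ← mul_assoc, hII] at e2
  simp only [Quaternion.re_add, Quaternion.re_smul, hv0, hIv, neg_mul, one_mul, Quaternion.re_neg,
    smul_eq_mul, mul_zero, add_zero, Quaternion.re_zero, mul_eq_zero, hy, false_or] at e1 e2
  rw [← hc]
  by_cases hst : s ^ 2 + t ^ 2 = 0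
  · have hs0 : s = 0 := by nlinarith [sq_nonneg s, sq_nonneg t]
    have ht0 : t = 0 := by nlinarith [sq_nonneg s, sq_nonneg t]
    have hvb : v * b = 0 := by simpa [hs0, ht0] using hsum
    have hb : b = 0 := by
      rcases mul_eq_zero.mp hvb with hv' | hb
      · exact absurd (by simp [hhv, hs0, ht0, hv']) h0
      · exact hb
    simp [hc, hb]
  · constructor
    · have : (s ^ 2 + t ^ 2) * c.re = 0 := by linear_combination s * e1 - t * e2
      simpa [hst] using this
    · have : (s ^ 2 + t ^ 2) * (I * c).re = 0 := by linear_combination t * e1 + s * e2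
      simpa [hst] using this

theorem exists_orthogonal_mem_QSphere (I : ℍ) : ∃ J ∈ QSphere, (I * J).re = 0 := by
  by_cases h : I.imI = 0 ∧ I.imJ = 0
  · exact ⟨unitI, unitI_mem_QSphere, by simp [h.1]⟩
  · obtain ⟨v, hv⟩ : ∃ v : ℍ, v = ⟨0, -I.imJ, I.imI, 0⟩ := ⟨_, rfl⟩
    have hv' : v ≠ 0 := by
      rintro rfl
      have h1 := congrArg QuaternionAlgebra.imI hv
      have h2 := congrArg QuaternionAlgebra.imJ hv
      simp at h1 h2
      exact h ⟨h2.symm, h1⟩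
    have hIv : (I * v).re = 0 := by
      have h0 : v.re = 0 := by rw [hv]
      have h1 : v.imI = -I.imJ := by rw [hv]
      have h2 : v.imJ = I.imI := by rw [hv]
      have h3 : v.imK = 0 := by rw [hv]
      rw [Quaternion.re_mul, h0, h1, h2, h3]
      ring
    obtain ⟨J, hJ, r, rfl⟩ := exists_eq_smul_mem_QSphere (by rw [hv]) hv'
    refine ⟨J, hJ, ?_⟩
    have hr : r ≠ 0 := by
      rintro rfl
      simp at hv'
    rw [mul_smul_comm] at hIv
    simpa [hr] using hIv

/-- A real affine function on the imaginary quaternions vanishing near a point of the unit sphere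
is zero. -/
theorem eq_zero_of_eventually_sphere {I B : ℍ} {p : ℝ} (hI : I ∈ QSphere)
    (h : ∀ J ∈ QSphere, (I * J).re = 0 →
      ∀ᶠ θ in nhds (0 : ℝ), p + ((Real.cos θ • I + Real.sin θ • J) * B).re = 0) :
    p = 0 ∧ B.im = 0 := by
  have key : ∀ J ∈ QSphere, (I * J).re = 0 → p = 0 ∧ (I * B).re = 0 ∧ (J * B).re = 0 := by
    intro J hJ hIJ
    obtain ⟨ε, hε, hball⟩ := Metric.eventually_nhds_iff.mp (h J hJ hIJ)
    have hform : ∀ θ : ℝ, |θ| < ε → p + Real.cos θ * (I * B).re + Real.sin θ * (J * B).re = 0 := by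
      intro θ hθ
      have := hball (y := θ) (by simpa using hθ)
      rw [add_mul, smul_mul_assoc, smul_mul_assoc, Quaternion.re_add, Quaternion.re_smul,
        Quaternion.re_smul] at this
      simpa [add_assoc] using this
    obtain ⟨θ, hθ0, hθε, hθ1⟩ : ∃ θ : ℝ, 0 < θ ∧ θ < ε ∧ θ < 1 :=
      ⟨min ε 1 / 2, by positivity, by linarith [min_le_left ε 1], by linarith [min_le_right ε 1]⟩
    have hsin : 0 < Real.sin θ := Real.sin_pos_of_pos_of_lt_pi hθ0 (by linarith [Real.pi_gt_three])
    have hcos : Real.cos θ ≠ 1 := fun hc => by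
      have := Real.sin_sq_add_cos_sq θ
      rw [hc] at this
      nlinarith
    have e0 := hform 0 (by simpa using hε)
    have e1 := hform θ (by rwa [abs_of_pos hθ0])
    have e2 := hform (-θ) (by rwa [abs_neg, abs_of_pos hθ0])
    simp only [Real.cos_zero, Real.sin_zero, Real.cos_neg, Real.sin_neg] at e0 e2
    have hJB : (J * B).re = 0 := by
      have : Real.sin θ * (J * B).re = 0 := by linarith
      simpa [hsin.ne'] using this
    have hIB : (I * B).re = 0 := by
      have : (Real.cos θ - 1) * (I * B).re = 0 := by
        rw [hJB] at e0 e1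
        linear_combination e1 - e0
      simpa [sub_ne_zero.mpr hcos] using this
    exact ⟨by rw [hIB, hJB] at e0; linarith, hIB, hJB⟩
  obtain ⟨J₀, hJ₀, hIJ₀⟩ := exists_orthogonal_mem_QSphere I
  obtain ⟨hp, hIB, -⟩ := key J₀ hJ₀ hIJ₀
  refine ⟨hp, ?_⟩
  have hII := (mem_QSphere_iff_mul_self I).mp hI
  have hI0 : I.re = 0 := ((mem_QSphere_iff I).mp hI).1
  obtain ⟨v, hv⟩ : ∃ v : ℍ, v = B.im + (I * B.im).re • I := ⟨_, rfl⟩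
  have hv0 : v.re = 0 := by
    rw [hv, Quaternion.re_add, Quaternion.re_smul, hI0]
    simp
  have hIv : (I * v).re = 0 := by
    rw [hv, mul_add, mul_smul_comm, hII, Quaternion.re_add, Quaternion.re_smul]
    simp
  have hvB : (v * B).re = 0 := by
    by_cases hv' : v = 0
    · simp [hv']
    · obtain ⟨J, hJ, r, rfl⟩ := exists_eq_smul_mem_QSphere hv0 hv'
      have hr : r ≠ 0 := by
        rintro rfl
        simp at hv'
      rw [mul_smul_comm] at hIv
      have := (key J hJ (by simpa [hr] using hIv)).2.2
      rw [smul_mul_assoc, Quaternion.re_smul, this, smul_zero]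
  have hmB : (B.im * B).re = 0 := by
    rw [hv, add_mul, smul_mul_assoc, Quaternion.re_add, Quaternion.re_smul, hIB] at hvB
    simpa using hvB
  simp at hmB
  have f1 : B.imI = 0 := by nlinarith [sq_nonneg B.imI, sq_nonneg B.imJ, sq_nonneg B.imK]
  have f2 : B.imJ = 0 := by nlinarith [sq_nonneg B.imI, sq_nonneg B.imJ, sq_nonneg B.imK]
  have f3 : B.imK = 0 := by nlinarith [sq_nonneg B.imI, sq_nonneg B.imJ, sq_nonneg B.imK]
  ext <;> simp [f1, f2, f3]

theorem fderiv_stem_eq_zero {α β : ℂ → ℍ} {D : Set ℂ} (h : StemCauchyRiemann α β D) {z : ℂ}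
    (hz : z ∈ D) (hα : fderiv ℝ α z 1 = 0) (hβ : fderiv ℝ β z 1 = 0) :
    fderiv ℝ α z = 0 ∧ fderiv ℝ β z = 0 := by
  obtain ⟨-, -, h1, h2⟩ := h z hz
  have hext : ∀ T : ℂ →L[ℝ] ℍ, T 1 = 0 → T Complex.I = 0 → T = 0 := by
    intro T hT1 hTI
    ext1 w
    have hw : w = w.re • (1 : ℂ) + w.im • Complex.I := by
      apply Complex.ext <;> simp
    rw [hw, map_add, map_smul, map_smul, hT1, hTI]
    simp
  exact ⟨hext _ hα (by rw [h1, hβ, neg_zero]), hext _ hβ (by rw [h2, hα])⟩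

/-- If the differential is singular near a point of a slice, then the derivative of the stem
function is orthogonal to its second component. -/
theorem stem_mul_star_eq_zero {Ω : Set ℍ} {f : ℍ → ℍ} (hf : SliceRegularOn f Ω)
    {α β : ℂ → ℍ} (hcr : StemCauchyRiemann α β (profile Ω)) (hΩ : IsSymmSliceDomain Ω)
    (hrep : ∀ J ∈ QSphere, ∀ z ∈ profile Ω, f (sliceMap J z) = α z + J * β z)
    {I : ℍ} (hI : I ∈ QSphere) {z : ℂ} (hz : z.im ≠ 0)
    (hq : sliceMap I z ∈ interior {q : ℍ | q ∈ Ω ∧ ¬ Function.Bijective (fderiv ℝ f q)}) :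
    fderiv ℝ α z 1 * star (β z) = 0 ∧ fderiv ℝ β z 1 * star (β z) = 0 := by
  have hzD : z ∈ profile Ω := (hΩ.mem_profile_iff hI).mpr (interior_subset hq).1
  obtain ⟨hα, hβ, -, -⟩ := hcr z hzD
  have hpt : ∀ K ∈ QSphere, ¬ Function.Bijective (fderiv ℝ f (sliceMap K z)) →
      ((fderiv ℝ α z 1 + K * fderiv ℝ β z 1) * star (β z)).re = 0 ∧
      (K * ((fderiv ℝ α z 1 + K * fderiv ℝ β z 1) * star (β z))).re = 0 := by
    intro K hK hbij
    have hqΩ := hzD K hK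
    have hd := hf.1 _ hqΩ
    have hcomp : HasFDerivAt (fun z => f (sliceMap K z))
        ((fderiv ℝ f (sliceMap K z)).comp (sliceMap K)) z :=
      hd.hasFDerivAt.comp z (sliceMap K).hasFDerivAt
    have hev : (fun z => f (sliceMap K z)) =ᶠ[nhds z] fun z => α z + K * β z := by
      filter_upwards [hΩ.isOpen_profile.mem_nhds hzD] with u hu using hrep K hK u hu
    have heq := hcomp.unique ((hasFDerivAt_add_mul hα hβ K).congr_of_eventuallyEq hev)
    have h1 : fderiv ℝ f (sliceMap K z) 1 = fderiv ℝ α z 1 + K * fderiv ℝ β z 1 := by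
      simpa [sliceMap_one] using congrArg (fun T : ℂ →L[ℝ] ℍ => T 1) heq
    have hLI : fderiv ℝ f (sliceMap K z) K =
        K * (fderiv ℝ α z 1 + K * fderiv ℝ β z 1) := by
      have h2 := (hf.leftHolomorphicOn hK z hzD).2
      rw [hcomp.fderiv] at h2
      simpa [sliceMap_one, sliceMap_I, h1] using h2
    refine re_eq_zero_of_not_injective hK hz h1 hLI (fun J hJ hKJ =>
      smul_fderiv_of_orthogonal hK hJ hKJ hd fun J' hJ' => hrep J' hJ' z hzD) fun hinj => ?_
    exact hbij ⟨hinj, (LinearMap.injective_iff_surjective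
      (f := (fderiv ℝ f (sliceMap K z) : ℍ →ₗ[ℝ] ℍ))).mp hinj⟩
  have hnear : ∀ J : ℍ, ∀ᶠ θ in nhds (0 : ℝ),
      sliceMap (Real.cos θ • I + Real.sin θ • J) z ∈
        interior {q : ℍ | q ∈ Ω ∧ ¬ Function.Bijective (fderiv ℝ f q)} := by
    intro J
    have hc : Continuous fun θ : ℝ => sliceMap (Real.cos θ • I + Real.sin θ • J) z := by
      simp only [sliceMap_apply]
      fun_prop
    exact (isOpen_interior.preimage hc).mem_nhds (by simpa using hq)
  obtain ⟨A, hA⟩ : ∃ A, A = fderiv ℝ α z 1 * star (β z) := ⟨_, rfl⟩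
  obtain ⟨B, hB⟩ : ∃ B, B = fderiv ℝ β z 1 * star (β z) := ⟨_, rfl⟩
  simp only [add_mul, mul_add, mul_assoc, ← hA, ← hB] at hpt
  rw [← hA, ← hB]
  have s1 := eq_zero_of_eventually_sphere (p := A.re) (B := B) hI fun J hJ hIJ => by
    filter_upwards [hnear J] with θ hθ
    have := (hpt _ (cos_smul_add_sin_smul_mem_QSphere hI hJ hIJ θ) (interior_subset hθ).2).1
    rwa [Quaternion.re_add] at this
  have s2 := eq_zero_of_eventually_sphere (p := -B.re) (B := A) hI fun J hJ hIJ => by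
    filter_upwards [hnear J] with θ hθ
    have hK := cos_smul_add_sin_smul_mem_QSphere hI hJ hIJ θ
    have := (hpt _ hK (interior_subset hθ).2).2
    rw [← mul_assoc _ _ B, (mem_QSphere_iff_mul_self _).mp hK, Quaternion.re_add] at this
    simpa [add_comm] using this
  constructor
  · rw [← Quaternion.re_add_im A, s1.1, s2.2]
    simp
  · rw [← Quaternion.re_add_im B, neg_eq_zero.mp s2.1, s1.2]
    simp

/-- A slice regular function whose stem function has vanishing derivative near a point is
constant. -/
theorem SliceRegularOn.exists_const {Ω : Set ℍ} {f : ℍ → ℍ} (hf : SliceRegularOn f Ω)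
    (hΩ : IsSymmSliceDomain Ω) {α β : ℂ → ℍ} (hcr : StemCauchyRiemann α β (profile Ω))
    (hrep : ∀ J ∈ QSphere, ∀ z ∈ profile Ω, f (sliceMap J z) = α z + J * β z)
    {z₁ : ℂ} (hz₁ : ∀ᶠ z in nhds z₁, z ∈ profile Ω ∧ fderiv ℝ α z 1 = 0 ∧ fderiv ℝ β z 1 = 0) :
    ∃ c : ℍ, ∀ q ∈ Ω, f q = c := by
  obtain ⟨ε, hε, hball⟩ := Metric.eventually_nhds_iff_ball.mp hz₁
  have hmem := Metric.mem_ball_self (x := z₁) hε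
  have hconst : ∀ z ∈ Metric.ball z₁ ε, α z = α z₁ ∧ β z = β z₁ := by
    have hzero := fun u (hu : u ∈ Metric.ball z₁ ε) =>
      fderiv_stem_eq_zero hcr (hball u hu).1 (hball u hu).2.1 (hball u hu).2.2
    have hc := (convex_ball z₁ ε).isPreconnected
    exact fun z hz =>
      ⟨Metric.isOpen_ball.is_const_of_fderiv_eq_zero (𝕜 := ℝ) hc
        (fun u hu => (hcr u (hball u hu).1).1.differentiableWithinAt)
        (fun u hu => (hzero u hu).1) hz hmem,
      Metric.isOpen_ball.is_const_of_fderiv_eq_zero (𝕜 := ℝ) hc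
        (fun u hu => (hcr u (hball u hu).1).2.1.differentiableWithinAt)
        (fun u hu => (hzero u hu).2) hz hmem⟩
  have hall : ∀ J ∈ QSphere, ∀ z ∈ profile Ω, f (sliceMap J z) = α z₁ + J * β z₁ := by
    intro J hJ z hz
    refine sub_eq_zero.mp (((hf.leftHolomorphicOn hJ).sub_const _).eqOn_zero hJ
      hΩ.isOpen_profile hΩ.isPreconnected_profile (hball z₁ hmem).1 ?_ z hz)
    apply Filter.Eventually.frequently
    apply eventually_nhdsWithin_of_eventually_nhds
    filter_upwards [Metric.ball_mem_nhds z₁ hε] with u hu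
    rw [hrep J hJ u (hball u hu).1, (hconst u hu).1, (hconst u hu).2, sub_self]
  obtain ⟨x, hx⟩ := hΩ.exists_real_mem_profile
  have hβ : β z₁ = 0 := by
    have h1 := hall _ unitI_mem_QSphere x hx
    have h2 := hall _ (neg_mem_QSphere unitI_mem_QSphere) x hx
    have h3 : sliceMap unitI (x : ℂ) = sliceMap (-unitI) (x : ℂ) := by simp [sliceMap_apply]
    rw [h3, h2] at h1
    have h4 : unitI * β z₁ = 0 := by
      rw [neg_mul] at h1
      have h5 : unitI * β z₁ + unitI * β z₁ = 0 := by
        nth_rewrite 1 [← add_left_cancel h1]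
        exact neg_add_cancel _
      rw [← two_smul ℝ] at h5
      simpa using h5
    rcases mul_eq_zero.mp h4 with h5 | h5
    · simpa using congrArg QuaternionAlgebra.imI h5
    · exact h5
  refine ⟨α z₁, fun q hq => ?_⟩
  obtain ⟨I, hI, z, rfl⟩ := exists_sliceMap_eq q
  rw [hall I hI z ((hΩ.mem_profile_iff hI).mpr hq), hβ, mul_zero, add_zero]

theorem exists_im_ne_zero_of_isOpen {V : Set ℂ} (hV : IsOpen V) {z : ℂ} (hz : z ∈ V) :
    ∃ w ∈ V, w.im ≠ 0 := by
  by_cases h : z.im = 0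
  · obtain ⟨ε, hε, hball⟩ := Metric.isOpen_iff.mp hV z hz
    refine ⟨z + ((ε / 2 : ℝ) : ℂ) * Complex.I, hball ?_, ?_⟩
    · rw [Metric.mem_ball, dist_eq_norm, add_sub_cancel_left, norm_mul, Complex.norm_I,
        Complex.norm_real, mul_one, Real.norm_of_nonneg (by positivity)]
      linarith
    · simp [h, hε.ne']
  · exact ⟨z, hz, h⟩

/-- A non-constant slice regular (continuously real-differentiable)
function on a symmetric slice domain has a singular set
`N_f = {q ∈ Ω : Df(q) not bijective}` with empty interior. -/
theorem statement7 (Ω : Set ℍ) (hΩ : IsSymmSliceDomain Ω) (f : ℍ → ℍ)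
    (hf : SliceRegularOn f Ω) (hC1 : ContDiffOn ℝ 1 f Ω)
    (hnc : ¬ ∃ c : ℍ, ∀ q ∈ Ω, f q = c) :
    interior {q : ℍ | q ∈ Ω ∧ ¬ Function.Bijective (fderiv ℝ f q)} = ∅ := by
  by_contra hne
  apply hnc
  obtain ⟨q, hq⟩ := Set.nonempty_iff_ne_empty.mpr hne
  obtain ⟨I, hI, z, rfl⟩ := exists_sliceMap_eq q
  obtain ⟨α, β, hcr, hrep⟩ := hf.exists_stem hΩ
  have hUo := isOpen_interior.preimage (sliceMap I).continuous
    (t := interior {q : ℍ | q ∈ Ω ∧ ¬ Function.Bijective (fderiv ℝ f q)})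
  obtain ⟨z₀, hz₀, him₀⟩ := exists_im_ne_zero_of_isOpen hUo hq
  have hevU : ∀ᶠ u in nhds z₀, sliceMap I u ∈
      interior {q : ℍ | q ∈ Ω ∧ ¬ Function.Bijective (fderiv ℝ f q)} ∧ u.im ≠ 0 :=
    (hUo.eventually_mem hz₀).and (Complex.continuous_im.continuousAt.eventually_ne him₀)
  have hmain : ∀ᶠ u in nhds z₀, u ∈ profile Ω ∧
      (β u ≠ 0 → fderiv ℝ α u 1 = 0 ∧ fderiv ℝ β u 1 = 0) := by
    filter_upwards [hevU] with u hu
    have h := stem_mul_star_eq_zero hf hcr hΩ hrep hI hu.2 hu.1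
    exact ⟨(hΩ.mem_profile_iff hI).mpr (interior_subset hu.1).1, fun hb =>
      ⟨by simpa [hb] using h.1, by simpa [hb] using h.2⟩⟩
  by_cases hb : ∀ᶠ u in nhds z₀, β u = 0
  · refine hf.exists_const hΩ hcr hrep (z₁ := z₀) ?_
    filter_upwards [hmain, hb.eventually_nhds] with u hu hbu
    have h0 : fderiv ℝ β u = 0 := by
      rw [Filter.EventuallyEq.fderiv_eq (f := fun _ : ℂ => (0 : ℍ)) hbu]
      simp
    refine ⟨hu.1, ?_, by simp [h0]⟩
    rw [← (hcr u hu.1).2.2.2, h0]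
    simp
  · obtain ⟨z₁, hz₁, hev⟩ := ((Filter.not_eventually.mp hb).and_eventually
      hmain.eventually_nhds).exists
    refine hf.exists_const hΩ hcr hrep (z₁ := z₁) ?_
    filter_upwards [hev, (hcr z₁ hev.self_of_nhds.1).2.1.continuousAt.eventually_ne hz₁]
      with u hu hbu
    exact ⟨hu.1, hu.2 hbu⟩
end

section
/- Let x₀, x₁ ∈ ℝ with x₀ < x₁² and x₁ > 0, and let c = x₀ + x₁i ∈ ℍ. Then there exist x, t ∈ ℝ with t > 0 such that {q ∈ ℍ : q² + qi = c} = {x + ti, −x − (t+1)i}; that is, one preimage has i-coefficient t > 0 and the other has i-coefficient −(t+1) < −1. (Hence at such points c the complex structures 𝕁⁺ and −𝕁⁻ induced by f(q) = q²+qi coincide.) -/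
open Quaternion

/-- The quaternion `i`. -/
def qi : ℍ := ⟨0, 1, 0, 0⟩

lemma re_qi : qi.re = 0 := rfl

lemma imI_qi : qi.imI = 1 := rfl

lemma imJ_qi : qi.imJ = 0 := rfl

lemma imK_qi : qi.imK = 0 := rfl

/-- The equation `q² + qi = x₀ + x₁ i` in real coordinates. -/
lemma sq_add_mul_qi_eq_iff (x₀ x₁ : ℝ) (q : ℍ) :
    q ^ 2 + q * qi = (x₀ : ℍ) + (x₁ : ℍ) * qi ↔
      q.re ^ 2 - q.imI ^ 2 - q.imI = x₀ ∧ 2 * q.re * q.imI + q.re = x₁ ∧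
        q.imJ = 0 ∧ q.imK = 0 := by
  rw [Quaternion.ext_iff]
  simp only [pow_two, re_qi, imI_qi, imJ_qi, imK_qi,
    Quaternion.re_add, Quaternion.imI_add, Quaternion.imJ_add,
    Quaternion.imK_add, Quaternion.re_mul, Quaternion.imI_mul, Quaternion.imJ_mul,
    Quaternion.imK_mul, Quaternion.re_coe, Quaternion.imI_coe, Quaternion.imJ_coe,
    Quaternion.imK_coe]
  obtain ⟨a, b, c, d⟩ := q
  dsimp only
  constructor
  · rintro ⟨h1, h2, h3, h4⟩
    have hpos : 4 * a ^ 2 + 1 ≠ 0 := by positivity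
    have hc : c = 0 := by
      apply (mul_eq_zero.mp (_ : (4 * a ^ 2 + 1) * c = 0)).resolve_left hpos
      linear_combination 2 * a * h3 - h4
    have hd : d = 0 := by
      apply (mul_eq_zero.mp (_ : (4 * a ^ 2 + 1) * d = 0)).resolve_left hpos
      linear_combination 2 * a * h4 + h3
    subst hc hd
    refine ⟨?_, ?_, rfl, rfl⟩ <;> linarith
  · rintro ⟨h1, h2, rfl, rfl⟩
    refine ⟨?_, ?_, ?_, ?_⟩ <;> linarith

/-- Outside the parabola, the complex number `x₀ - 1/4 + x₁ i` has a square root `x + s i` with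
`x > 0` and `s > 1/2`. -/
lemma exists_sqrt_im_gt_half (x₀ x₁ : ℝ) (h : x₀ < x₁ ^ 2) (hx₁ : 0 < x₁) :
    ∃ x s : ℝ, 0 < x ∧ 1 / 2 < s ∧ x ^ 2 - s ^ 2 = x₀ - 1 / 4 ∧ 2 * x * s = x₁ := by
  set r := √((x₀ - 1 / 4) ^ 2 + x₁ ^ 2)
  have hr : r ^ 2 = (x₀ - 1 / 4) ^ 2 + x₁ ^ 2 := Real.sq_sqrt (by positivity)
  have hlt : x₀ + 1 / 4 < r := Real.lt_sqrt_of_sq_lt (by nlinarith)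
  have hs : 1 / 2 < √((r - (x₀ - 1 / 4)) / 2) := Real.lt_sqrt_of_sq_lt (by linarith)
  have hs2 : √((r - (x₀ - 1 / 4)) / 2) ^ 2 = (r - (x₀ - 1 / 4)) / 2 :=
    Real.sq_sqrt (by linarith)
  generalize √((r - (x₀ - 1 / 4)) / 2) = s at hs hs2
  have hs0 : 0 < s := by linarith
  refine ⟨x₁ / (2 * s), s, by positivity, hs, ?_, by field_simp⟩
  have hr' : r = 2 * s ^ 2 + (x₀ - 1 / 4) := by linarith
  rw [hr'] at hr
  field_simp
  linear_combination -4 * hr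

/-- Complex square roots are unique up to sign, in real coordinates. -/
lemma eq_or_eq_neg_of_sq_coords {a b x s : ℝ} (hx : x ≠ 0)
    (h₁ : a ^ 2 - b ^ 2 = x ^ 2 - s ^ 2) (h₂ : a * b = x * s) :
    (a = x ∧ b = s) ∨ (a = -x ∧ b = -s) := by
  have key : (a ^ 2 - x ^ 2) * (a ^ 2 + s ^ 2) = 0 := by
    linear_combination a ^ 2 * h₁ + (a * b + x * s) * h₂
  have ha : a ^ 2 = x ^ 2 := by
    rcases mul_eq_zero.mp key with h | h
    · linarith
    · have : 0 < x ^ 2 := by positivity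
      nlinarith [sq_nonneg a, sq_nonneg b, sq_nonneg s]
  rcases sq_eq_sq_iff_eq_or_eq_neg.mp ha with rfl | rfl
  · exact Or.inl ⟨rfl, mul_left_cancel₀ hx h₂⟩
  · exact Or.inr ⟨rfl, mul_left_cancel₀ hx (by linarith)⟩

/-- If `c = x₀ + x₁ i` lies outside the parabola (`x₀ < x₁²`) with
`x₁ > 0`, then there exist `x, t ∈ ℝ` with `t > 0` such that the fibre
`{q : q² + qi = c}` is exactly `{x + ti, -x - (t+1)i}`. -/
theorem statement14 (x₀ x₁ : ℝ) (h : x₀ < x₁ ^ 2) (hx₁ : 0 < x₁) :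
    ∃ x t : ℝ, 0 < t ∧
      {q : ℍ | q ^ 2 + q * qi = (x₀ : ℍ) + (x₁ : ℍ) * qi} =
        {(x : ℍ) + (t : ℍ) * qi, -(x : ℍ) - ((t + 1 : ℝ) : ℍ) * qi} := by
  obtain ⟨x, s, hx, hs, h₁, h₂⟩ := exists_sqrt_im_gt_half x₀ x₁ h hx₁
  refine ⟨x, s - 1 / 2, by linarith, ?_⟩
  ext q
  rw [Set.mem_ofPred_eq, sq_add_mul_qi_eq_iff, Set.mem_insert_iff, Set.mem_singleton_iff,
    Quaternion.ext_iff, Quaternion.ext_iff]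
  simp only [re_qi, imI_qi, imJ_qi, imK_qi,
    Quaternion.re_add, Quaternion.imI_add, Quaternion.imJ_add,
    Quaternion.imK_add, Quaternion.re_sub, Quaternion.imI_sub, Quaternion.imJ_sub,
    Quaternion.imK_sub, Quaternion.re_neg, Quaternion.imI_neg, Quaternion.imJ_neg,
    Quaternion.imK_neg, Quaternion.re_mul, Quaternion.imI_mul, Quaternion.imJ_mul,
    Quaternion.imK_mul, Quaternion.re_coe, Quaternion.imI_coe, Quaternion.imJ_coe,
    Quaternion.imK_coe]
  obtain ⟨a, b, c, d⟩ := q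
  dsimp only
  constructor
  · rintro ⟨e₁, e₂, rfl, rfl⟩
    rcases eq_or_eq_neg_of_sq_coords (a := a) (b := b + 1 / 2) (s := s) hx.ne'
      (by linarith) (by linarith) with ⟨rfl, hb⟩ | ⟨rfl, hb⟩
    · left
      refine ⟨?_, ?_, ?_, ?_⟩ <;> linarith
    · right
      refine ⟨?_, ?_, ?_, ?_⟩ <;> linarith
  · rintro (⟨ha, hb, hc, hd⟩ | ⟨ha, hb, hc, hd⟩)
    · obtain rfl : a = x := by linarith
      obtain rfl : b = s - 1 / 2 := by linarith
      refine ⟨?_, ?_, ?_, ?_⟩ <;> linarith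
    · obtain rfl : a = -x := by linarith
      obtain rfl : b = -s - 1 / 2 := by linarith
      refine ⟨?_, ?_, ?_, ?_⟩ <;> linarith
end
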